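/- Law of order estimation, Case II with m odd and (ε = −1 or δ = 1): if the characteristic exponent m is an odd positive integer and ε = −1 or δ = 1, then the averaged T¹-type quantity satisfies ⟨A⟩(Δr) = O(Δr^{m−1}) as Δr → 0⁺, i.e. Δr^{1−m}·⟨A⟩(Δr) stays bounded for small Δr > 0. -/

import Mathlib

open Filter Finset

noncomputable section

/-- Transition probability η on trits: η(0) = (β/2)(1 − Pe/2), η(1) = 1 − β,
η(2) = (β/2)(1 + Pe/2). -/
def eta (β Pe : ℝ) (ω : Fin 3) : ℝ :=
  if (ω : ℕ) = 0 then β / 2 * (1 - Pe / 2)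
  else if (ω : ℕ) = 1 then 1 - β
  else β / 2 * (1 + Pe / 2)

/-- ν(ω) = η(2 − ω). -/
def nu (β Pe : ℝ) (ω : Fin 3) : ℝ :=
  if (ω : ℕ) = 0 then β / 2 * (1 + Pe / 2)
  else if (ω : ℕ) = 1 then 1 - β
  else β / 2 * (1 - Pe / 2)

/-- Bulk local density ρ̂ⱼ(u′) = (∏ η(u_d)/ν(u_d)) · ρ₀(r + (j + Σ (1 − u_d))·Δr). -/
def rhoHat (β Pe r Δr : ℝ) (ρ₀ : ℝ → ℝ) {K : ℕ} (j : ℤ) (u : Fin K → Fin 3) : ℝ :=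
  (∏ d, eta β Pe (u d) / nu β Pe (u d)) *
    ρ₀ (r + ((j : ℝ) + ∑ d, (1 - ((u d : ℕ) : ℝ))) * Δr)

/-- F_j(ω, u) with u = u₀u′ :
F_j(ω,u) = f((η(ω)/ν(ω))·ρ̂_j(u′), (η(u₀)/ν(u₀))·ρ̂_{j+1−u₀}(u′)). -/
def Floc (β Pe r Δr : ℝ) (ρ₀ : ℝ → ℝ) (f : ℝ → ℝ → ℝ) {K : ℕ}
    (j : ℤ) (ω u₀ : Fin 3) (u' : Fin K → Fin 3) : ℝ :=
  f (eta β Pe ω / nu β Pe ω * rhoHat β Pe r Δr ρ₀ j u')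
    (eta β Pe u₀ / nu β Pe u₀ * rhoHat β Pe r Δr ρ₀ (j + 1 - ((u₀ : ℕ) : ℤ)) u')

/-- K(Δr): the sum over the trit ω and the k-digit trit string u = u₀u′. -/
def Ksum (D v β r : ℝ) (k : ℕ) (ρ₀ : ℝ → ℝ) (f : ℝ → ℝ → ℝ)
    (ε δ : ℝ) (m : ℕ) (Δr : ℝ) : ℝ :=
  Δr * ∑ ω : Fin 3, ∑ u₀ : Fin 3, ∑ u' : Fin (k - 1) → Fin 3,
    (eta β (v * Δr / D) ω + δ * nu β (v * Δr / D) ω) *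
      (nu β (v * Δr / D) u₀ * ∏ d, nu β (v * Δr / D) (u' d)) *
      (Floc β (v * Δr / D) r Δr ρ₀ f 0 ω u₀ u' +
        ε * (-1 : ℝ) ^ m * Floc β (v * Δr / D) r Δr ρ₀ f (1 - ((ω : ℕ) : ℤ)) ω u₀ u')

/-- The spatio-temporally averaged T¹-type quantity ⟨A⟩(Δr) = K/(τ·Δr),
with τ = β·Δr²/(2D). -/
def avgA (D v β r : ℝ) (k : ℕ) (ρ₀ : ℝ → ℝ) (f : ℝ → ℝ → ℝ)
    (ε δ : ℝ) (m : ℕ) (Δr : ℝ) : ℝ :=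
  Ksum D v β r k ρ₀ f ε δ m Δr / (β * Δr ^ 2 / (2 * D) * Δr)

/-- f̃(X,Y) = f(Y + X, Y − X). -/
def ftilde (f : ℝ → ℝ → ℝ) (X Y : ℝ) : ℝ := f (Y + X) (Y - X)

open Asymptotics Topology

/-- Iterated partial derivatives in the first variable of a smooth function are jointly smooth. -/
lemma exists_contDiff_iteratedDeriv_fst {F : ℝ × ℝ → ℝ} (hF : ContDiff ℝ (⊤ : ℕ∞) F) (n : ℕ) :
    ∃ G : ℝ × ℝ → ℝ, ContDiff ℝ (⊤ : ℕ∞) G ∧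
      ∀ Y X, iteratedDeriv n (fun X => F (X, Y)) X = G (X, Y) := by
  induction n with
  | zero => exact ⟨F, hF, by simp⟩
  | succ n ih =>
    obtain ⟨G, hG, hGF⟩ := ih
    refine ⟨fun p => fderiv ℝ G p (1, 0), ?_, fun Y X => ?_⟩
    · exact (hG.fderiv_right (m := (⊤ : ℕ∞)) (by simp)).clm_apply contDiff_const
    · rw [iteratedDeriv_succ, funext (hGF Y)]
      have hfd : HasFDerivAt G (fderiv ℝ G (X, Y)) (X, Y) :=
        (hG.differentiable (by simp) (X, Y)).hasFDerivAt
      exact (hfd.comp_hasDerivAt X ((hasDerivAt_id X).prodMk (hasDerivAt_const X Y))).deriv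

/-- Lagrange form of the remainder for a function all of whose derivatives below order `n + 1`
vanish at `0`. -/
lemma exists_lagrange_of_iteratedDeriv_eq_zero {g : ℝ → ℝ} (hg : ContDiff ℝ (⊤ : ℕ∞) g) {n : ℕ}
    (h0 : ∀ j < n + 1, iteratedDeriv j g 0 = 0) (x : ℝ) :
    ∃ ξ, |ξ| ≤ |x| ∧
      g x = iteratedDeriv (n + 1) g ξ / ((n + 1).factorial : ℝ) * x ^ (n + 1) := by
  rcases eq_or_ne 0 x with rfl | hx
  · exact ⟨0, le_rfl, by simpa using h0 0 (Nat.succ_pos n)⟩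
  · obtain ⟨ξ, hξ, h⟩ := taylor_mean_remainder_lagrange_iteratedDeriv (f := g) (n := n) hx
      ((hg.of_le (by exact_mod_cast le_top)).contDiffOn)
    have hT : taylorWithinEval g n (Set.uIcc 0 x) 0 x = 0 := by
      rw [taylor_within_apply]
      refine Finset.sum_eq_zero fun j hj => ?_
      rw [iteratedDerivWithin_eq_iteratedDeriv (uniqueDiffOn_uIcc hx)
        (hg.contDiffAt.of_le (by exact_mod_cast le_top)) Set.left_mem_uIcc,
        h0 j (Finset.mem_range.1 hj), smul_zero]
    refine ⟨ξ, ?_, ?_⟩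
    · simpa using Set.abs_sub_left_of_mem_uIcc (Set.uIoo_subset_uIcc_self hξ)
    · rw [hT, sub_zero, sub_zero] at h
      rw [h]
      ring

/-- First-order expansion with quadratic remainder of a `C²` function. -/
lemma ContDiffAt.isBigO_sub_affine {g : ℝ → ℝ} {g' : ℝ} (hg : ContDiffAt ℝ 2 g 0)
    (hg' : HasDerivAt g g' 0) :
    (fun t => g t - g 0 - g' * t) =O[𝓝 0] fun t => t ^ 2 := by
  obtain ⟨u, hu, hgu⟩ := hg.contDiffOn (m := 2) le_rfl (by simp)
  obtain ⟨R, hR, hball⟩ := Metric.mem_nhds_iff.1 hu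
  have hnhds : Metric.ball (0 : ℝ) R ∈ 𝓝 (0 : ℝ) := Metric.ball_mem_nhds 0 hR
  have hT := (taylor_isLittleO (n := 2) (convex_ball 0 R) (Metric.mem_ball_self hR)
    (hgu.mono hball)).isBigO
  rw [nhdsWithin_eq_nhds.2 hnhds] at hT
  set c := iteratedDerivWithin 2 g (Metric.ball 0 R) 0
  have hq : (fun t : ℝ => c / 2 * t ^ 2) =O[𝓝 0] fun t => t ^ 2 := isBigO_const_mul_self _ _ _
  have hT' := hT.add (by simpa using hq)
  refine hT'.congr' (Eventually.of_forall fun t => ?_) (by simp)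
  have hd : derivWithin g (Metric.ball 0 R) 0 = g' := by
    rw [derivWithin_of_mem_nhds hnhds, hg'.deriv]
  simp [taylorWithinEval_succ, iteratedDerivWithin_one, hd]
  ring

/-- Replacing each factor by its leading term costs one order. -/
lemma isBigO_mul_sub_mul_pow {p q : ℝ → ℝ} {p₀ q₀ : ℝ} {n : ℕ}
    (hp : (fun t => p t - p₀) =O[𝓝 0] fun t => t)
    (hq : (fun t => q t - q₀ * t ^ n) =O[𝓝 0] fun t => t ^ (n + 1)) :
    (fun t => p t * q t - p₀ * q₀ * t ^ n) =O[𝓝 0] fun t => t ^ (n + 1) := by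
  have hid : (fun t : ℝ => t) =O[𝓝 0] fun _ => (1 : ℝ) :=
    (continuous_id.tendsto (0 : ℝ)).isBigO_one ℝ
  have hp1 : p =O[𝓝 0] fun _ => (1 : ℝ) := by
    simpa using (hp.trans hid).add (isBigO_const_const p₀ one_ne_zero (𝓝 0))
  have h1 := hp1.mul hq
  have h2 := hp.mul (isBigO_const_mul_self q₀ (fun t : ℝ => t ^ n) (𝓝 0))
  refine ((h1.congr_right fun t => one_mul _).add
    (h2.congr_right fun t => (pow_succ' t n).symm)).congr_left fun t => ?_
  ring

lemma isBigO_pow_sub_pow {p : ℝ → ℝ} {c : ℝ}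
    (hp : (fun t => p t - c * t) =O[𝓝 0] fun t => t ^ 2) (n : ℕ) :
    (fun t => p t ^ n - c ^ n * t ^ n) =O[𝓝 0] fun t => t ^ (n + 1) := by
  have hid : (fun t : ℝ => t) =O[𝓝 0] fun _ => (1 : ℝ) :=
    (continuous_id.tendsto (0 : ℝ)).isBigO_one ℝ
  have hp1 : p =O[𝓝 0] fun t => t := by
    have h2 : (fun t : ℝ => t ^ 2) =O[𝓝 0] fun t => t := by
      simpa [pow_two] using hid.mul (isBigO_refl (fun t : ℝ => t) (𝓝 0))
    simpa using (hp.trans h2).add (isBigO_const_mul_self c (fun t : ℝ => t) (𝓝 0))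
  induction n with
  | zero => simpa using isBigO_zero _ _
  | succ n ih =>
    have h1 := hp1.mul ih
    have h2 := hp.mul (isBigO_const_mul_self (c ^ n) (fun t : ℝ => t ^ n) (𝓝 0))
    refine ((h1.congr_right fun t => (pow_succ' t (n + 1)).symm).add
      (h2.congr_right fun t => ?_)).congr_left fun t => ?_
    · ring
    · ring

/-- Leading-order expansion of `f` along a curve that meets the diagonal at `t = 0`. -/
lemma isBigO_comp_curve_sub {f : ℝ → ℝ → ℝ} (hf : ContDiff ℝ (⊤ : ℕ∞) (Function.uncurry f))
    {m : ℕ} (hm : 0 < m)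
    (hlow : ∀ Y : ℝ, ∀ j < m, iteratedDeriv j (fun X => ftilde f X Y) 0 = 0)
    {a b : ℝ → ℝ} {y a' b' : ℝ} (ha : ContDiffAt ℝ 2 a 0) (hb : ContDiffAt ℝ 2 b 0)
    (ha' : HasDerivAt a a' 0) (hb' : HasDerivAt b b' 0) (ha0 : a 0 = y) (hb0 : b 0 = y) :
    (fun t => f (a t) (b t) - iteratedDeriv m (fun X => ftilde f X y) 0 / (m.factorial : ℝ) *
      ((a' - b') / 2) ^ m * t ^ m) =O[𝓝 0] fun t => t ^ (m + 1) := by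
  obtain ⟨n, rfl⟩ := Nat.exists_eq_succ_of_ne_zero hm.ne'
  simp only [Nat.succ_eq_add_one] at *
  have hF : ContDiff ℝ (⊤ : ℕ∞) (fun p : ℝ × ℝ => ftilde f p.1 p.2) :=
    hf.comp (f := fun p : ℝ × ℝ => (p.2 + p.1, p.2 - p.1)) (by fun_prop)
  obtain ⟨G, hG, hGF⟩ := exists_contDiff_iteratedDeriv_fst hF (n + 1)
  have hFY (Y : ℝ) : ContDiff ℝ (⊤ : ℕ∞) (fun X => ftilde f X Y) :=
    hF.comp (f := fun X : ℝ => (X, Y)) (by fun_prop)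
  choose ξ hξ hfξ using fun t : ℝ => exists_lagrange_of_iteratedDeriv_eq_zero
    (hFY ((a t + b t) / 2)) (hlow _) ((a t - b t) / 2)
  have hX' : HasDerivAt (fun t => (a t - b t) / 2) ((a' - b') / 2) 0 := (ha'.sub hb').div_const 2
  have hY' : HasDerivAt (fun t => (a t + b t) / 2) ((a' + b') / 2) 0 := (ha'.add hb').div_const 2
  have hX2 := ((ha.sub hb).div_const 2).isBigO_sub_affine hX'
  have hXO : (fun t => (a t - b t) / 2) =O[𝓝 0] fun t => t := by
    simpa [ha0, hb0] using hX'.differentiableAt.isBigO_sub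
  have hYO : (fun t => (a t + b t) / 2 - y) =O[𝓝 0] fun t => t := by
    simpa [ha0, hb0] using hY'.differentiableAt.isBigO_sub
  have hξO : ξ =O[𝓝 0] fun t => t :=
    (IsBigO.of_bound 1 (Eventually.of_forall fun t => by
      simpa only [one_mul, Real.norm_eq_abs] using hξ t)).trans hXO
  have hid : Tendsto (fun t : ℝ => t) (𝓝 0) (𝓝 0) := tendsto_id
  have hZ : Tendsto (fun t => (ξ t, (a t + b t) / 2)) (𝓝 0) (𝓝 ((0 : ℝ), y)) := by
    refine (hξO.trans_tendsto hid).prodMk_nhds ?_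
    simpa using (hYO.trans_tendsto hid).add_const y
  have hGO : (fun t => G (ξ t, (a t + b t) / 2) - G (0, y)) =O[𝓝 0] fun t => t := by
    refine ((hG.differentiable (by simp) (0, y)).isBigO_sub.comp_tendsto hZ).trans ?_
    refine IsBigO.prod_left ?_ ?_
    · simpa [Function.comp_def] using hξO
    · simpa [Function.comp_def] using hYO
  have hGO' := hGO.const_mul_left (((n + 1).factorial : ℝ)⁻¹)
  have hpow := isBigO_pow_sub_pow (p := fun t => (a t - b t) / 2) (c := (a' - b') / 2)
    (by simpa [ha0, hb0] using hX2) (n + 1)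
  refine (isBigO_mul_sub_mul_pow (p := fun t => ((n + 1).factorial : ℝ)⁻¹ *
    G (ξ t, (a t + b t) / 2)) (p₀ := ((n + 1).factorial : ℝ)⁻¹ * G (0, y))
    (hGO'.congr_left fun t => by ring) hpow).congr_left fun t => ?_
  have hft : f (a t) (b t) = ftilde f ((a t - b t) / 2) ((a t + b t) / 2) := by
    unfold ftilde; congr 1 <;> ring
  rw [hft, hfξ t, hGF, hGF]
  ring

lemma eta_zero_eq_nu_zero (β : ℝ) (ω : Fin 3) : eta β 0 ω = nu β 0 ω := by
  simp [eta, nu]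

lemma nu_zero_ne_zero {β : ℝ} (hβ0 : 0 < β) (hβ1 : β < 1) (ω : Fin 3) : nu β 0 ω ≠ 0 := by
  unfold nu
  split_ifs <;> [simp; skip; simp] <;> linarith

lemma contDiff_eta (β V : ℝ) (ω : Fin 3) : ContDiff ℝ 2 fun t => eta β (V * t) ω := by
  unfold eta
  split_ifs <;> fun_prop

lemma contDiff_nu (β V : ℝ) (ω : Fin 3) : ContDiff ℝ 2 fun t => nu β (V * t) ω := by
  unfold nu
  split_ifs <;> fun_prop

lemma contDiffAt_eta_div_nu {β : ℝ} (hβ0 : 0 < β) (hβ1 : β < 1) (V : ℝ) (ω : Fin 3) :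
    ContDiffAt ℝ 2 (fun t => eta β (V * t) ω / nu β (V * t) ω) 0 :=
  (contDiff_eta β V ω).contDiffAt.div (contDiff_nu β V ω).contDiffAt
    (by simpa using nu_zero_ne_zero hβ0 hβ1 ω)

lemma eta_div_nu_zero {β : ℝ} (hβ0 : 0 < β) (hβ1 : β < 1) (ω : Fin 3) :
    eta β 0 ω / nu β 0 ω = 1 := by
  rw [eta_zero_eq_nu_zero, div_self (nu_zero_ne_zero hβ0 hβ1 ω)]

lemma hasDerivAt_eta_div_nu {β : ℝ} (hβ0 : 0 < β) (hβ1 : β < 1) (V : ℝ) (ω : Fin 3) :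
    HasDerivAt (fun t => eta β (V * t) ω / nu β (V * t) ω) ((((ω : ℕ) : ℝ) - 1) * V) 0 := by
  have hV : HasDerivAt (fun t : ℝ => V * t / 2) (V / 2) 0 := by
    simpa using ((hasDerivAt_id (0 : ℝ)).const_mul V).div_const 2
  have hm : HasDerivAt (fun t : ℝ => β / 2 * (1 - V * t / 2)) (β / 2 * -(V / 2)) 0 :=
    (hV.const_sub 1).const_mul _
  have hp : HasDerivAt (fun t : ℝ => β / 2 * (1 + V * t / 2)) (β / 2 * (V / 2)) 0 :=
    (hV.const_add 1).const_mul _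
  have hβ : β ≠ 0 := hβ0.ne'
  have hβ' : 1 - β ≠ 0 := by linarith
  fin_cases ω
  · simp only [eta, nu]
    refine (hm.div hp (by simpa using hβ)).congr_deriv ?_
    simp
    field_simp
    ring
  · simpa [eta, nu, hβ'] using hasDerivAt_const (0 : ℝ) (1 : ℝ)
  · simp only [eta, nu]
    refine (hp.div hm (by simpa using hβ)).congr_deriv ?_
    simp
    field_simp
    ring

section Density

variable {β V r : ℝ} {ρ₀ : ℝ → ℝ} {K : ℕ}

lemma rhoHat_zero (hβ0 : 0 < β) (hβ1 : β < 1) (j : ℤ) (u : Fin K → Fin 3) :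
    rhoHat β 0 r 0 ρ₀ j u = ρ₀ r := by
  simp [rhoHat, eta_div_nu_zero hβ0 hβ1]

lemma contDiffAt_rhoHat (hβ0 : 0 < β) (hβ1 : β < 1) (hρ : ContDiff ℝ (⊤ : ℕ∞) ρ₀) (j : ℤ)
    (u : Fin K → Fin 3) : ContDiffAt ℝ 2 (fun t => rhoHat β (V * t) r t ρ₀ j u) 0 := by
  unfold rhoHat
  refine (contDiffAt_prod fun d _ => contDiffAt_eta_div_nu hβ0 hβ1 V (u d)).mul ?_
  exact ((contDiff_infty.1 hρ 2).comp (by fun_prop)).contDiffAt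

/-- The derivative of `ρ̂ⱼ` at `Δr = 0` depends on the site `j` only through `j ρ₀'(r)`. -/
lemma exists_hasDerivAt_rhoHat (hβ0 : 0 < β) (hβ1 : β < 1) (hρ : ContDiff ℝ (⊤ : ℕ∞) ρ₀)
    (u : Fin K → Fin 3) :
    ∃ B, ∀ j : ℤ, HasDerivAt (fun t => rhoHat β (V * t) r t ρ₀ j u) (B + j * deriv ρ₀ r) 0 := by
  have hP : DifferentiableAt ℝ
      (fun t => ∏ d, eta β (V * t) (u d) / nu β (V * t) (u d)) 0 :=
    (contDiffAt_prod fun d _ => contDiffAt_eta_div_nu hβ0 hβ1 V (u d)).differentiableAt (by simp)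
  refine ⟨deriv (fun t => ∏ d, eta β (V * t) (u d) / nu β (V * t) (u d)) 0 * ρ₀ r +
    (∑ d, (1 - ((u d : ℕ) : ℝ))) * deriv ρ₀ r, fun j => ?_⟩
  set s := ∑ d, (1 - ((u d : ℕ) : ℝ)) with hs
  have hlin : HasDerivAt (fun t : ℝ => r + ((j : ℝ) + s) * t) ((j : ℝ) + s) 0 := by
    simpa using ((hasDerivAt_id (0 : ℝ)).const_mul ((j : ℝ) + s)).const_add r
  have hρr : HasDerivAt ρ₀ (deriv ρ₀ r) (r + ((j : ℝ) + s) * 0) := by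
    simpa using (hρ.differentiable (by simp) r).hasDerivAt
  refine (hP.hasDerivAt.mul (hρr.comp 0 hlin)).congr_deriv ?_
  simp [eta_div_nu_zero hβ0 hβ1]
  ring

lemma isBigO_Floc_sub {f : ℝ → ℝ → ℝ} (hβ0 : 0 < β) (hβ1 : β < 1)
    (hρ : ContDiff ℝ (⊤ : ℕ∞) ρ₀) (hf : ContDiff ℝ (⊤ : ℕ∞) (Function.uncurry f))
    {m : ℕ} (hm : 0 < m)
    (hlow : ∀ Y : ℝ, ∀ j < m, iteratedDeriv j (fun X => ftilde f X Y) 0 = 0)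
    (j : ℤ) (ω u₀ : Fin 3) (u : Fin K → Fin 3) :
    (fun t => Floc β (V * t) r t ρ₀ f j ω u₀ u -
      iteratedDeriv m (fun X => ftilde f X (ρ₀ r)) 0 / (m.factorial : ℝ) *
        (((((ω : ℕ) : ℝ) - 1) * (V * ρ₀ r) -
          (((u₀ : ℕ) : ℝ) - 1) * (V * ρ₀ r - deriv ρ₀ r)) / 2) ^ m * t ^ m)
      =O[𝓝 0] fun t => t ^ (m + 1) := by
  obtain ⟨B, hB⟩ := exists_hasDerivAt_rhoHat (V := V) (r := r) hβ0 hβ1 hρ u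
  have hval (i : ℤ) (ω : Fin 3) :
      eta β (V * 0) ω / nu β (V * 0) ω * rhoHat β (V * 0) r 0 ρ₀ i u = ρ₀ r := by
    simp [eta_div_nu_zero hβ0 hβ1, rhoHat_zero hβ0 hβ1]
  have hsmooth (i : ℤ) (ω : Fin 3) := (contDiffAt_eta_div_nu hβ0 hβ1 V ω).mul
    (contDiffAt_rhoHat (V := V) (r := r) hβ0 hβ1 hρ i u)
  have hderiv (i : ℤ) (ω : Fin 3) := (hasDerivAt_eta_div_nu hβ0 hβ1 V ω).mul (hB i)
  refine (isBigO_comp_curve_sub hf hm hlow (hsmooth j ω) (hsmooth (j + 1 - ((u₀ : ℕ) : ℤ)) u₀)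
    (hderiv j ω) (hderiv (j + 1 - ((u₀ : ℕ) : ℤ)) u₀) (hval _ _) (hval _ _)).congr_left
    fun t => ?_
  simp only [mul_zero, eta_div_nu_zero hβ0 hβ1, rhoHat_zero hβ0 hβ1, Floc]
  push_cast
  ring_nf

end Density

/-- The symmetric trit weights annihilate odd powers of linear forms in the centred trits. -/
lemma sum_nu_zero_mul_odd_pow {m : ℕ} (hm : Odd m) (β p q : ℝ) :
    ∑ ω : Fin 3, ∑ u₀ : Fin 3, nu β 0 ω * nu β 0 u₀ *
      (((((ω : ℕ) : ℝ) - 1) * p - (((u₀ : ℕ) : ℝ) - 1) * q) / 2) ^ m = 0 := by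
  have h1 : ((-p + q) / 2) ^ m = -((p - q) / 2) ^ m := by rw [← hm.neg_pow]; ring
  have h2 : ((-p - q) / 2) ^ m = -((p + q) / 2) ^ m := by rw [← hm.neg_pow]; ring
  have h3 : (-p / 2) ^ m = -(p / 2) ^ m := by rw [← hm.neg_pow]; ring
  have h4 : (-q / 2) ^ m = -(q / 2) ^ m := by rw [← hm.neg_pow]; ring
  have h5 : (2 : ℝ) - 1 = 1 := by norm_num
  have h0 : m ≠ 0 := hm.pos.ne'
  simp only [Fin.sum_univ_three, nu, Fin.val_zero, Fin.val_one, Fin.val_two]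
  simp only [Nat.cast_zero, Nat.cast_one, Nat.cast_ofNat, h5, zero_sub, neg_one_mul, sub_self,
    zero_mul, one_mul, sub_zero, h1, h2, h3, sub_neg_eq_add, h4, zero_div,
    zero_pow h0]
  norm_num
  ring

/-- LOE, Case II with m odd and (ε = −1 or δ = 1): ⟨A⟩(Δr) = O(Δr^(m−1)). -/
theorem LOE_caseII_first
    (D v β r : ℝ) (k : ℕ) (ρ₀ : ℝ → ℝ) (f : ℝ → ℝ → ℝ)
    (ε δ : ℝ) (m : ℕ) (Chat : ℝ → ℝ)
    (hD : 0 < D) (hβ0 : 0 < β) (hβ1 : β < 1) (hk : 1 ≤ k)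
    (hρ : ContDiff ℝ (⊤ : ℕ∞) ρ₀) (hρpos : ∀ x, 0 < ρ₀ x)
    (hf : ContDiff ℝ (⊤ : ℕ∞) (Function.uncurry f))
    (hε : ε = 1 ∨ ε = -1) (hδ : δ = 1 ∨ δ = -1)
    (hsym : ∀ x y, f y x = (-1 : ℝ) ^ m * f x y)
    (hlow : ∀ Y : ℝ, ∀ j < m, iteratedDeriv j (fun X => ftilde f X Y) 0 = 0)
    (hchar : ∀ Y : ℝ, iteratedDeriv m (fun X => ftilde f X Y) 0 = (m.factorial : ℝ) * Chat Y)
    (hCbdd : ∃ M : ℝ, ∀ y, |Chat y| ≤ M) (hCne : ∀ y, Chat y ≠ 0)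
    (hmo : Odd m) (hcase : ε = -1 ∨ δ = 1) :
    ∃ C > 0, ∃ Δ₀ > 0, ∀ Δr : ℝ, 0 < Δr → Δr < Δ₀ →
      |avgA D v β r k ρ₀ f ε δ m Δr| ≤ C * Δr ^ ((m : ℤ) - 1) := by
  have hm : 0 < m := hmo.pos
  set V := v / D with hV
  set c := iteratedDeriv m (fun X => ftilde f X (ρ₀ r)) 0 / (m.factorial : ℝ) with hc
  let A (ω u₀ : Fin 3) : ℝ := ((((ω : ℕ) : ℝ) - 1) * (V * ρ₀ r) -
    (((u₀ : ℕ) : ℝ) - 1) * (V * ρ₀ r - deriv ρ₀ r)) / 2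
  let W (ω u₀ : Fin 3) (u : Fin (k - 1) → Fin 3) (t : ℝ) : ℝ :=
    (eta β (V * t) ω + δ * nu β (V * t) ω) * (nu β (V * t) u₀ * ∏ d, nu β (V * t) (u d))
  have hterm (ω u₀ : Fin 3) (u : Fin (k - 1) → Fin 3) :
      (fun t => W ω u₀ u t * (Floc β (V * t) r t ρ₀ f 0 ω u₀ u +
        ε * (-1 : ℝ) ^ m * Floc β (V * t) r t ρ₀ f (1 - ((ω : ℕ) : ℤ)) ω u₀ u) -
        W ω u₀ u 0 * ((1 + ε * (-1 : ℝ) ^ m) * (c * A ω u₀ ^ m)) * t ^ m)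
        =O[𝓝 0] fun t => t ^ (m + 1) := by
    have hW : ContDiff ℝ 2 (W ω u₀ u) :=
      ((contDiff_eta β V ω).add (contDiff_const.mul (contDiff_nu β V ω))).mul
        ((contDiff_nu β V u₀).mul (contDiff_prod fun d _ => contDiff_nu β V (u d)))
    refine isBigO_mul_sub_mul_pow ?_ ?_
    · simpa using (hW.differentiable (by simp) 0).isBigO_sub
    · refine ((isBigO_Floc_sub (V := V) (r := r) hβ0 hβ1 hρ hf hm hlow 0 ω u₀ u).add
        ((isBigO_Floc_sub (V := V) (r := r) hβ0 hβ1 hρ hf hm hlow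
          (1 - ((ω : ℕ) : ℤ)) ω u₀ u).const_mul_left
          (ε * (-1 : ℝ) ^ m))).congr_left fun t => ?_
      simp only [A, hc]
      ring
  have hzero : ∑ ω : Fin 3, ∑ u₀ : Fin 3, ∑ u : Fin (k - 1) → Fin 3,
      W ω u₀ u 0 * ((1 + ε * (-1 : ℝ) ^ m) * (c * A ω u₀ ^ m)) = 0 := by
    have hs := sum_nu_zero_mul_odd_pow hmo β (V * ρ₀ r) (V * ρ₀ r - deriv ρ₀ r)
    refine Eq.trans ?_ (mul_eq_zero_of_right ((1 + δ) * (1 + ε * (-1 : ℝ) ^ m) * c *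
      ∑ u : Fin (k - 1) → Fin 3, ∏ d, nu β 0 (u d)) hs)
    rw [Finset.mul_sum]
    refine Finset.sum_congr rfl fun ω _ => ?_
    rw [Finset.mul_sum]
    refine Finset.sum_congr rfl fun u₀ _ => ?_
    rw [Finset.mul_sum, Finset.sum_mul]
    refine Finset.sum_congr rfl fun u _ => ?_
    simp only [W, A, mul_zero, eta_zero_eq_nu_zero]
    ring
  have hS : (fun t => ∑ ω : Fin 3, ∑ u₀ : Fin 3, ∑ u : Fin (k - 1) → Fin 3,
      (W ω u₀ u t * (Floc β (V * t) r t ρ₀ f 0 ω u₀ u +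
        ε * (-1 : ℝ) ^ m * Floc β (V * t) r t ρ₀ f (1 - ((ω : ℕ) : ℤ)) ω u₀ u) -
        W ω u₀ u 0 * ((1 + ε * (-1 : ℝ) ^ m) * (c * A ω u₀ ^ m)) * t ^ m))
      =O[𝓝 0] fun t => t ^ (m + 1) :=
    IsBigO.fun_sum fun ω _ => IsBigO.fun_sum fun u₀ _ => IsBigO.fun_sum fun u _ => hterm ω u₀ u
  obtain ⟨C, hC, hbound⟩ := hS.exists_pos
  obtain ⟨R, hR, hball⟩ := Metric.eventually_nhds_iff.1 hbound.bound
  refine ⟨C * (2 * D / β), by positivity, R, hR, fun t ht htR => ?_⟩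
  have hb := hball (y := t) (by simpa [abs_of_pos ht] using htR)
  have hzt := congrArg (· * t ^ m) hzero
  simp only [Finset.sum_mul, zero_mul] at hzt
  simp only [Finset.sum_sub_distrib, hzt, sub_zero] at hb
  have hVt : v * t / D = V * t := by rw [hV]; ring
  unfold avgA Ksum
  simp only [hVt]
  rw [zpow_sub_one₀ ht.ne', zpow_natCast]
  simp only [Real.norm_eq_abs, abs_of_pos (pow_pos ht (m + 1))] at hb
  rw [abs_div, abs_mul, abs_of_pos ht, abs_of_pos (show 0 < β * t ^ 2 / (2 * D) * t by positivity),
    div_le_iff₀ (by positivity)]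
  calc _ ≤ t * (C * t ^ (m + 1)) := mul_le_mul_of_nonneg_left hb ht.le
    _ = _ := by rw [pow_succ]; field_simp
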